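/- arXiv:1307.0454 — 3 statements merged into one kernel-verified Lean document; each statement's English description precedes it below -/
import Mathlib

section
/- Let g be a real vector space, let c : g → g be a linear map and let s : g → g be a linear automorphism. Define J : g × g → g × g by J(u,v) = (−s(v) − c(s⁻¹(u + c(v))), s⁻¹(u + c(v))). Then J is linear and J ∘ J = −id, i.e. J is a complex structure on the real vector space g × g. -/
/-- For a real vector space `g`, a linear map `c : g → g` and a linear
automorphism `s : g → g`, the map `J(u,v) = (−s(v) − c(s⁻¹(u + c(v))), s⁻¹(u + c(v)))`
is linear and satisfies `J ∘ J = −id`, i.e. it is a complex structure on `g × g`. -/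
theorem stmt0 {g : Type*} [AddCommGroup g] [Module ℝ g]
    (c : g →ₗ[ℝ] g) (s : g ≃ₗ[ℝ] g) (J : g × g → g × g)
    (hJ : ∀ u v : g,
      J (u, v) = (-(s v) - c (s.symm (u + c v)), s.symm (u + c v))) :
    IsLinearMap ℝ J ∧ ∀ p : g × g, J (J p) = -p := by
  refine ⟨⟨?_, ?_⟩, ?_⟩
  · rintro ⟨u, v⟩ ⟨u', v'⟩
    simp only [Prod.mk_add_mk, hJ, map_add, Prod.mk.injEq]
    constructor <;> abel
  · rintro r ⟨u, v⟩
    simp only [Prod.smul_mk, hJ, map_add, map_smul, smul_sub, smul_add, smul_neg]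
  · rintro ⟨u, v⟩
    have h : -(s v) - c (s.symm (u + c v)) + c (s.symm (u + c v)) = -(s v) := by abel
    rw [hJ, hJ, h, map_neg, s.symm_apply_apply, s.apply_symm_apply, map_neg, Prod.neg_mk]
    congr 1
    abel
end

section
/- Let g be a real vector space, c : g → g a linear map, s : g → g a linear automorphism, and define the linear maps θ, L : g × g → g by θ(u,v) = u + c(v) and L(u,v) = s(v). Then there is exactly one linear endomorphism J of g × g satisfying θ ∘ J = −L and L ∘ J = θ; this J satisfies J ∘ J = −id and is given explicitly by J(u,v) = (−s(v) − c(s⁻¹(u + c(v))), s⁻¹(u + c(v))). -/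
/-- For a real vector space `g`, a linear map `c`, a linear automorphism `s`,
and the linear maps `θ(u,v) = u + c(v)`, `L(u,v) = s(v)` on `g × g`, there is exactly one
linear endomorphism `J` of `g × g` with `θ ∘ J = −L` and `L ∘ J = θ`; moreover any such `J`
satisfies `J ∘ J = −id` and is given by
`J(u,v) = (−s(v) − c(s⁻¹(u + c(v))), s⁻¹(u + c(v)))`. -/
theorem stmt1 {g : Type*} [AddCommGroup g] [Module ℝ g]
    (c : g →ₗ[ℝ] g) (s : g ≃ₗ[ℝ] g)
    (θ L : g × g →ₗ[ℝ] g)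
    (hθ : ∀ u v : g, θ (u, v) = u + c v)
    (hL : ∀ u v : g, L (u, v) = s v) :
    (∃! J : (g × g) →ₗ[ℝ] (g × g), θ.comp J = -L ∧ L.comp J = θ) ∧
    ∀ J : (g × g) →ₗ[ℝ] (g × g), (θ.comp J = -L ∧ L.comp J = θ) →
      (∀ p : g × g, J (J p) = -p) ∧
      (∀ u v : g, J (u, v) = (-(s v) - c (s.symm (u + c v)), s.symm (u + c v))) := by
  have key : ∀ J : (g × g) →ₗ[ℝ] (g × g), (θ.comp J = -L ∧ L.comp J = θ) →
      ∀ u v : g, J (u, v) = (-(s v) - c (s.symm (u + c v)), s.symm (u + c v)) := by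
    rintro J ⟨h1, h2⟩ u v
    have e1 : θ (J (u, v)) = -L (u, v) := LinearMap.congr_fun h1 (u, v)
    have e2 : L (J (u, v)) = θ (u, v) := LinearMap.congr_fun h2 (u, v)
    generalize J (u, v) = q at e1 e2 ⊢
    obtain ⟨a, b⟩ := q
    rw [hθ, hL] at e1
    rw [hθ, hL] at e2
    have hb : b = s.symm (u + c v) := by rw [← e2, s.symm_apply_apply]
    rw [← hb, ← e1, add_sub_cancel_right]
  refine ⟨⟨LinearMap.prod (-L - c.comp (s.symm.toLinearMap.comp θ))
    (s.symm.toLinearMap.comp θ), ⟨?_, ?_⟩, ?_⟩, ?_⟩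
  · refine LinearMap.ext fun p => ?_
    simp [hθ]
  · refine LinearMap.ext fun p => ?_
    simp [hL]
  · intro J hJ
    refine LinearMap.ext fun p => ?_
    obtain ⟨u, v⟩ := p
    rw [key J hJ u v]
    simp [hθ, hL]
  · intro J hJ
    refine ⟨?_, key J hJ⟩
    rintro ⟨u, v⟩
    rw [key J hJ u v, key J hJ]
    simp
end

section
/- Let E be a real inner product space, φ : ℝ → ℝ a differentiable function, and Φ : ℝ → ℝ a differentiable function with Φ' = φ/2. Define χ_E : E → E by χ_E(a) = φ(‖a‖²) • a and F : E → ℝ by F(a) = ‖a‖² φ(‖a‖²) − Φ(‖a‖²). Then for all a, v ∈ E one has (DF)_a(v) = ⟨a, (Dχ_E)_a(v)⟩; that is, the real 1-form a ↦ ⟨a, (Dχ_E)_a(·)⟩ on E is exact with primitive F, and in particular closed. -/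
open scoped RealInnerProductSpace

/-- Let `E` be a real inner product space, `φ : ℝ → ℝ` differentiable, and
`Φ : ℝ → ℝ` differentiable with `Φ' = φ/2`. With `χ_E(a) = φ(‖a‖²) • a` and
`F(a) = ‖a‖² φ(‖a‖²) − Φ(‖a‖²)`, both are differentiable and
`(DF)_a(v) = ⟪a, (Dχ_E)_a(v)⟫` for all `a, v`; i.e. the 1-form
`a ↦ ⟪a, (Dχ_E)_a(·)⟫` is exact with primitive `F` (in particular closed). -/
theorem stmt8 {E : Type*} [NormedAddCommGroup E] [InnerProductSpace ℝ E]
    (φ Φ : ℝ → ℝ) (hφ : Differentiable ℝ φ) (hΦ : Differentiable ℝ Φ)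
    (hΦ' : ∀ x : ℝ, deriv Φ x = φ x / 2) :
    ∀ a : E,
      DifferentiableAt ℝ (fun x : E => ‖x‖ ^ 2 * φ (‖x‖ ^ 2) - Φ (‖x‖ ^ 2)) a ∧
      DifferentiableAt ℝ (fun x : E => φ (‖x‖ ^ 2) • x) a ∧
      ∀ v : E,
        fderiv ℝ (fun x : E => ‖x‖ ^ 2 * φ (‖x‖ ^ 2) - Φ (‖x‖ ^ 2)) a v =
          ⟪a, fderiv ℝ (fun x : E => φ (‖x‖ ^ 2) • x) a v⟫ := by
  intro a
  have hn : HasFDerivAt (fun x : E => ‖x‖ ^ 2) (2 • innerSL ℝ a) a :=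
    (hasStrictFDerivAt_norm_sq a).hasFDerivAt
  have h1 : HasFDerivAt (fun x : E => φ (‖x‖ ^ 2))
      (deriv φ (‖a‖ ^ 2) • (2 • innerSL ℝ a)) a :=
    (hφ (‖a‖ ^ 2)).hasDerivAt.comp_hasFDerivAt a hn
  have h2 : HasFDerivAt (fun x : E => Φ (‖x‖ ^ 2))
      (deriv Φ (‖a‖ ^ 2) • (2 • innerSL ℝ a)) a :=
    (hΦ (‖a‖ ^ 2)).hasDerivAt.comp_hasFDerivAt a hn
  have h3 := (hn.fun_mul h1).fun_sub h2
  have h4 := h1.fun_smul (hasFDerivAt_id a)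
  simp only [id] at h4
  refine ⟨h3.differentiableAt, h4.differentiableAt, fun v => ?_⟩
  rw [h3.fderiv, h4.fderiv, hΦ']
  simp [inner_add_right, inner_smul_right, real_inner_self_eq_norm_sq]
  ring
end
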